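/- Let d ≥ 1 be an integer and let f(z) = Σ_{ℓ≥0} a_ℓ z^ℓ be a power series with positive radius of convergence, so that its q-Borel transform of order 1/d, g(ζ) := Σ_{ℓ≥0} a_ℓ q^{−ℓ(ℓ−1)d/2} ζ^ℓ, defines an entire function. Then for every λ ∈ ℂ* there exists R > 0 such that for all z with 0 < |z| < R and z ∉ −λq^{dℤ}, the bilateral series Σ_{ℓ∈dℤ} g(q^ℓλ)/Θ_{q^d}(q^{d+ℓ}λ/z) converges absolutely and its sum equals f(z). (That is, L_{1/d}^{[λ]} ∘ B̂_{1/d}(f) = f near 0.) -/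

import Mathlib

/-- The theta function `Θ_Q(z) = Σ_{ℓ ∈ ℤ} Q^(-ℓ(ℓ+1)/2) z^ℓ`. -/
noncomputable def theta (Q z : ℂ) : ℂ := ∑' ℓ : ℤ, Q ^ (-(ℓ * (ℓ + 1)) / 2) * z ^ ℓ

/-- The exponent `-ℓ(ℓ+1)/2` is an exact quotient. -/
lemma two_mul_theta_exponent (ℓ : ℤ) : 2 * (-(ℓ * (ℓ + 1)) / 2) = -(ℓ * (ℓ + 1)) :=
  Int.mul_ediv_cancel' (dvd_neg.mpr (Int.even_mul_succ_self ℓ).two_dvd)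

/-- The coefficient `Q^(-ℓ(ℓ+1)/2)` of the theta function. -/
noncomputable def thetaCoeff (Q : ℂ) (ℓ : ℤ) : ℂ := Q ^ (-(ℓ * (ℓ + 1)) / 2)

lemma thetaCoeff_ne_zero {Q : ℂ} (hQ : Q ≠ 0) (ℓ : ℤ) : thetaCoeff Q ℓ ≠ 0 :=
  zpow_ne_zero _ hQ

lemma thetaCoeff_add {Q : ℂ} (hQ : Q ≠ 0) (a b : ℤ) :
    thetaCoeff Q (a + b) = thetaCoeff Q a * thetaCoeff Q b * Q ^ (-(a * b)) := by
  unfold thetaCoeff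
  rw [← zpow_add₀ hQ, ← zpow_add₀ hQ]
  congr 1
  have h := two_mul_theta_exponent (a + b)
  have ha := two_mul_theta_exponent a
  have hb := two_mul_theta_exponent b
  linarith

lemma thetaCoeff_neg_one_sub (Q : ℂ) (a : ℤ) : thetaCoeff Q (-1 - a) = thetaCoeff Q a := by
  unfold thetaCoeff
  congr 3
  ring

lemma thetaCoeff_zero (Q : ℂ) : thetaCoeff Q 0 = 1 := by simp [thetaCoeff]

lemma thetaCoeff_add_one {Q : ℂ} (hQ : Q ≠ 0) (a : ℤ) :
    thetaCoeff Q (a + 1) = thetaCoeff Q a * Q⁻¹ ^ (a + 1) := by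
  have h1 : thetaCoeff Q 1 = Q⁻¹ := by simp [thetaCoeff]
  rw [thetaCoeff_add hQ, h1, inv_zpow', neg_add, zpow_add₀ hQ, zpow_neg_one, mul_one]
  ring

lemma theta_eq_tsum (Q z : ℂ) : theta Q z = ∑' ℓ : ℤ, thetaCoeff Q ℓ * z ^ ℓ := rfl

lemma summable_thetaCoeff_nat {Q : ℂ} (hQ : 1 < ‖Q‖) {z : ℂ} (hz : z ≠ 0) :
    Summable fun n : ℕ => thetaCoeff Q n * z ^ n := by
  have hQ0 : Q ≠ 0 := norm_pos_iff.mp (one_pos.trans hQ)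
  have hp : ‖Q⁻¹‖ < 1 := by rw [norm_inv]; exact inv_lt_one_of_one_lt₀ hQ
  refine summable_of_ratio_test_tendsto_lt_one (l := 0) one_pos
    (Filter.Eventually.of_forall fun n =>
      mul_ne_zero (thetaCoeff_ne_zero hQ0 _) (pow_ne_zero _ hz)) ?_
  have hlim : Filter.Tendsto (fun n : ℕ => ‖Q⁻¹‖ ^ (n + 1) * ‖z‖) Filter.atTop (nhds (0 * ‖z‖)) :=
    ((tendsto_pow_atTop_nhds_zero_of_lt_one (norm_nonneg _) hp).comp
      (Filter.tendsto_add_atTop_nat 1)).mul_const _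
  rw [zero_mul] at hlim
  refine hlim.congr fun n => ?_
  have hc : thetaCoeff Q ((n + 1 : ℕ) : ℤ) = thetaCoeff Q n * Q⁻¹ ^ (n + 1) := by
    rw [Nat.cast_succ, thetaCoeff_add_one hQ0]
    norm_cast
  have h1 : ‖thetaCoeff Q n‖ ≠ 0 := norm_ne_zero_iff.mpr (thetaCoeff_ne_zero hQ0 _)
  have h2 : ‖z‖ ≠ 0 := norm_ne_zero_iff.mpr hz
  rw [hc, norm_mul, norm_mul, norm_mul, norm_pow, norm_pow, norm_pow, pow_succ ‖z‖]
  field_simp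

lemma summable_theta {Q : ℂ} (hQ : 1 < ‖Q‖) {z : ℂ} (hz : z ≠ 0) :
    Summable fun ℓ : ℤ => thetaCoeff Q ℓ * z ^ ℓ := by
  refine Summable.of_nat_of_neg_add_one ?_ ?_
  · simpa using summable_thetaCoeff_nat hQ hz
  · refine ((summable_thetaCoeff_nat hQ (inv_ne_zero hz)).mul_right z⁻¹).congr fun n => ?_
    have h : -((n : ℤ) + 1) = -1 - n := by ring
    rw [h, thetaCoeff_neg_one_sub, ← h, zpow_neg, ← inv_zpow, mul_assoc, ← pow_succ]
    norm_cast

lemma theta_zpow_mul {Q : ℂ} (hQ : Q ≠ 0) {z : ℂ} (hz : z ≠ 0) (m : ℤ) :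
    theta Q (Q ^ m * z) = (thetaCoeff Q (-m))⁻¹ * z ^ m * theta Q z := by
  rw [theta_eq_tsum, theta_eq_tsum, ← (Equiv.addRight (-m)).tsum_eq
    (fun ℓ : ℤ => thetaCoeff Q ℓ * z ^ ℓ), ← tsum_mul_left]
  refine tsum_congr fun ℓ => ?_
  have h := thetaCoeff_ne_zero hQ (-m)
  have hzm : z ^ m ≠ 0 := zpow_ne_zero _ hz
  simp only [Equiv.coe_addRight]
  rw [thetaCoeff_add hQ, zpow_add₀ hz, mul_zpow, ← zpow_mul, mul_neg, neg_neg, zpow_neg,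
    mul_comm m ℓ]
  field_simp

lemma theta_inv (Q : ℂ) {z : ℂ} (hz : z ≠ 0) : theta Q z⁻¹ = z * theta Q z := by
  rw [theta_eq_tsum, theta_eq_tsum, ← (Equiv.subLeft (-1 : ℤ)).tsum_eq, ← tsum_mul_left]
  refine tsum_congr fun ℓ => ?_
  simp only [Equiv.subLeft_apply]
  rw [thetaCoeff_neg_one_sub, inv_zpow', neg_sub, sub_neg_eq_add, zpow_add₀ hz, zpow_one]
  ring

/-- The finite `q`-Pochhammer symbol `(p; p)_m = ∏_{i=1}^m (1 - p^i)`. -/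
noncomputable def qPoch (p : ℂ) (m : ℕ) : ℂ := ∏ i ∈ Finset.range m, (1 - p ^ (i + 1))

lemma one_sub_pow_succ_ne_zero {p : ℂ} (hp : ‖p‖ < 1) (n : ℕ) : 1 - p ^ (n + 1) ≠ 0 := by
  intro h
  have h1 : ‖p‖ ^ (n + 1) < 1 := pow_lt_one₀ (norm_nonneg _) hp n.succ_ne_zero
  rw [← norm_pow, ← sub_eq_zero.mp h, norm_one] at h1
  exact lt_irrefl _ h1

lemma qPoch_ne_zero {p : ℂ} (hp : ‖p‖ < 1) (m : ℕ) : qPoch p m ≠ 0 :=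
  Finset.prod_ne_zero_iff.mpr fun i _ => one_sub_pow_succ_ne_zero hp i

lemma qPoch_succ (p : ℂ) (m : ℕ) : qPoch p (m + 1) = qPoch p m * (1 - p ^ (m + 1)) :=
  Finset.prod_range_succ _ _

lemma exists_tendsto_prod_one_add {f : ℕ → ℂ} (hf : Summable fun n => ‖f n‖)
    (h0 : ∀ n, 1 + f n ≠ 0) :
    ∃ L : ℂ, L ≠ 0 ∧ Filter.Tendsto (fun n => ∏ i ∈ Finset.range n, (1 + f i)) Filter.atTop
      (nhds L) :=
  ⟨_, tprod_one_add_ne_zero_of_summable h0 hf,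
    (multipliable_one_add_of_summable hf).hasProd.tendsto_prod_nat⟩

lemma summable_norm_pow_mul {p : ℂ} (hp : ‖p‖ < 1) (c : ℂ) :
    Summable fun n : ℕ => ‖p ^ n * c‖ := by
  simp only [norm_mul, norm_pow]
  exact (summable_geometric_of_lt_one (norm_nonneg _) hp).mul_right _

lemma exists_tendsto_qPoch {p : ℂ} (hp : ‖p‖ < 1) :
    ∃ L : ℂ, L ≠ 0 ∧ Filter.Tendsto (qPoch p) Filter.atTop (nhds L) := by
  have h : ∀ n : ℕ, 1 + p ^ n * -p = 1 - p ^ (n + 1) := fun n => by ring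
  obtain ⟨L, hL, hlim⟩ := exists_tendsto_prod_one_add (summable_norm_pow_mul hp (-p))
    fun n => by rw [h]; exact one_sub_pow_succ_ne_zero hp n
  refine ⟨L, hL, hlim.congr fun n => ?_⟩
  simp only [h, qPoch]

/-- The reciprocal `1 / (p; p)_m`, extended by zero to negative integers `m`. -/
noncomputable def qPochInv (p : ℂ) : ℤ → ℂ
  | Int.ofNat m => (qPoch p m)⁻¹
  | Int.negSucc _ => 0

lemma qPochInv_natCast (p : ℂ) (m : ℕ) : qPochInv p m = (qPoch p m)⁻¹ := rfl

lemma qPochInv_of_neg (p : ℂ) {m : ℤ} (hm : m < 0) : qPochInv p m = 0 := by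
  obtain ⟨n, rfl⟩ := Int.eq_negSucc_of_lt_zero hm
  rfl

lemma qPochInv_sub_one {p : ℂ} (hp : ‖p‖ < 1) (m : ℤ) :
    qPochInv p (m - 1) = (1 - p ^ m) * qPochInv p m := by
  rcases lt_trichotomy m 0 with hm | rfl | hm
  · rw [qPochInv_of_neg p hm, qPochInv_of_neg p (by omega), mul_zero]
  · rw [qPochInv_of_neg p (by omega), zpow_zero, sub_self, zero_mul]
  · obtain ⟨n, rfl⟩ : ∃ n : ℕ, m = (n : ℤ) + 1 := ⟨(m - 1).toNat, by omega⟩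
    have h1 := one_sub_pow_succ_ne_zero hp n
    have h2 := qPoch_ne_zero hp n
    rw [add_sub_cancel_right, qPochInv_natCast, ← Nat.cast_succ, qPochInv_natCast, qPoch_succ,
      zpow_natCast]
    field_simp

lemma tendsto_qPochInv {p L : ℂ} (hL : L ≠ 0)
    (hlim : Filter.Tendsto (qPoch p) Filter.atTop (nhds L)) :
    Filter.Tendsto (qPochInv p) Filter.atTop (nhds L⁻¹) := by
  rw [← Nat.map_cast_int_atTop, Filter.tendsto_map'_iff]
  exact hlim.inv₀ hL

lemma exists_norm_le_of_tendsto {f : ℕ → ℂ} {L : ℂ}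
    (hlim : Filter.Tendsto f Filter.atTop (nhds L)) : ∃ M : ℝ, 0 ≤ M ∧ ∀ n, ‖f n‖ ≤ M := by
  obtain ⟨M, hM⟩ := (Metric.isBounded_range_of_tendsto f hlim).exists_norm_le
  exact ⟨M, (norm_nonneg _).trans (hM _ ⟨0, rfl⟩), fun n => hM _ ⟨n, rfl⟩⟩

/-- The Gaussian binomial coefficient `[2n choose n + k]_p`. -/
noncomputable def centralGaussBinom (p : ℂ) (n : ℕ) (k : ℤ) : ℂ :=
  qPoch p (2 * n) * qPochInv p (n + k) * qPochInv p (n - k)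

lemma centralGaussBinom_zero (p : ℂ) (k : ℤ) :
    centralGaussBinom p 0 k = if k = 0 then 1 else 0 := by
  split_ifs with hk
  · subst hk
    have h : qPochInv p 0 = 1 := by
      rw [← Nat.cast_zero, qPochInv_natCast]
      simp [qPoch]
    simp [centralGaussBinom, h, qPoch]
  · rcases lt_or_gt_of_ne hk with hk | hk
    · simp [centralGaussBinom, qPochInv_of_neg p hk]
    · simp [centralGaussBinom, qPochInv_of_neg p (neg_neg_of_pos hk)]

lemma centralGaussBinom_succ {p : ℂ} (hp0 : p ≠ 0) (hp : ‖p‖ < 1) (n : ℕ) (k : ℤ) :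
    centralGaussBinom p (n + 1) k = (1 + p ^ (2 * n + 1)) * centralGaussBinom p n k
      + p ^ (n + 1 - k : ℤ) * centralGaussBinom p n (k - 1)
      + p ^ (n + 1 + k : ℤ) * centralGaussBinom p n (k + 1) := by
  set A := p ^ (n + 1 + k : ℤ) with hA
  set B := p ^ (n + 1 - k : ℤ) with hB
  have hAB : A * B = p ^ (2 * n + 1) * p := by
    rw [hA, hB, ← zpow_add₀ hp0, ← pow_succ, ← zpow_natCast]
    congr 1
    push_cast
    ring
  have hA' : p ^ (n + k : ℤ) = A * p⁻¹ := by
    rw [hA, ← zpow_sub_one₀ hp0]; congr 1; ring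
  have hB' : p ^ (n - k : ℤ) = B * p⁻¹ := by
    rw [hB, ← zpow_sub_one₀ hp0]; congr 1; ring
  have u1 : qPochInv p (n + k) = (1 - A) * qPochInv p (n + 1 + k) := by
    rw [hA, ← qPochInv_sub_one hp]; congr 1; ring
  have u2 : qPochInv p (n + k - 1) = (1 - A * p⁻¹) * qPochInv p (n + k) := by
    rw [← hA', ← qPochInv_sub_one hp]
  have v1 : qPochInv p (n - k) = (1 - B) * qPochInv p (n + 1 - k) := by
    rw [hB, ← qPochInv_sub_one hp]; congr 1; ring
  have v2 : qPochInv p (n - k - 1) = (1 - B * p⁻¹) * qPochInv p (n - k) := by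
    rw [← hB', ← qPochInv_sub_one hp]
  have e1 : (n : ℤ) + (k - 1) = n + k - 1 := by ring
  have e2 : (n : ℤ) - (k - 1) = n + 1 - k := by ring
  have e3 : (n : ℤ) + (k + 1) = n + 1 + k := by ring
  have e4 : (n : ℤ) - (k + 1) = n - k - 1 := by ring
  have hP : qPoch p (2 * (n + 1)) = qPoch p (2 * n) * (1 - p ^ (2 * n + 1)) * (1 - A * B) := by
    rw [show 2 * (n + 1) = 2 * n + 1 + 1 by ring, qPoch_succ, qPoch_succ, pow_succ p (2 * n + 1),
      hAB]
  have hp' : p ^ (2 * n + 1) = A * B * p⁻¹ := by rw [hAB]; field_simp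
  simp only [centralGaussBinom, Nat.cast_succ]
  rw [e1, e2, e3, e4, hP, hp', u2, v2, u1, v1]
  ring

/-- A finite form of the Jacobi triple product identity. -/
lemma hasSum_finite_tripleProduct {Q : ℂ} (hQ : 1 < ‖Q‖) {z : ℂ} (hz : z ≠ 0) (n : ℕ) :
    HasSum (fun k : ℤ => centralGaussBinom Q⁻¹ n k * (thetaCoeff Q k * z ^ k))
      (∏ i ∈ Finset.range n, ((1 + Q⁻¹ ^ i * (Q⁻¹ * z)) * (1 + Q⁻¹ ^ i * z⁻¹))) := by
  have hQ0 : Q ≠ 0 := norm_pos_iff.mp (one_pos.trans hQ)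
  have hp0 : Q⁻¹ ≠ 0 := inv_ne_zero hQ0
  have hp : ‖Q⁻¹‖ < 1 := by rw [norm_inv]; exact inv_lt_one_of_one_lt₀ hQ
  induction n with
  | zero =>
    simp only [centralGaussBinom_zero, Finset.range_zero, Finset.prod_empty]
    convert hasSum_ite_eq (0 : ℤ) (1 : ℂ) using 2 with k
    split_ifs with hk
    · simp [hk, thetaCoeff_zero]
    · simp
  | succ n ih =>
    rw [Finset.prod_range_succ]
    have hup := ((Equiv.addRight (1 : ℤ)).hasSum_iff.mpr ih).mul_left (Q⁻¹ ^ n * z⁻¹)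
    have hdown := ((Equiv.addRight (-1 : ℤ)).hasSum_iff.mpr ih).mul_left (Q⁻¹ ^ n * (Q⁻¹ * z))
    have hval (P : ℂ) : P * ((1 + Q⁻¹ ^ n * (Q⁻¹ * z)) * (1 + Q⁻¹ ^ n * z⁻¹)) =
        (1 + Q⁻¹ ^ (2 * n + 1)) * P + Q⁻¹ ^ n * (Q⁻¹ * z) * P + Q⁻¹ ^ n * z⁻¹ * P := by
      linear_combination P * Q⁻¹ ^ (2 * n + 1) * mul_inv_cancel₀ hz
    rw [hval]
    refine (((ih.mul_left (1 + Q⁻¹ ^ (2 * n + 1))).add hdown).add hup).congr_fun fun k => ?_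
    simp only [Function.comp_apply, Equiv.coe_addRight]
    have hk := thetaCoeff_add_one hQ0 (k + -1)
    rw [neg_add_cancel_right] at hk
    rw [centralGaussBinom_succ hp0 hp, thetaCoeff_add_one hQ0 k, hk, ← sub_eq_add_neg,
      zpow_sub_one₀ hz, zpow_add_one₀ hz, zpow_sub₀ hp0, zpow_add₀ hp0 (n + 1) k, zpow_add_one₀ hp0,
      zpow_add_one₀ hp0, zpow_natCast]
    field_simp

lemma theta_ne_zero {Q : ℂ} (hQ : 1 < ‖Q‖) {z : ℂ} (hz : z ≠ 0) (h : ∀ m : ℤ, z ≠ -Q ^ m) :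
    theta Q z ≠ 0 := by
  have hQ0 : Q ≠ 0 := norm_pos_iff.mp (one_pos.trans hQ)
  have hp : ‖Q⁻¹‖ < 1 := by rw [norm_inv]; exact inv_lt_one_of_one_lt₀ hQ
  obtain ⟨L₁, hL₁, hlim₁⟩ := exists_tendsto_prod_one_add (summable_norm_pow_mul hp (Q⁻¹ * z))
    fun n hn => h (n + 1) <| by
      rw [zpow_add_one₀ hQ0, zpow_natCast, inv_pow] at *
      have hQn : Q ^ n ≠ 0 := pow_ne_zero _ hQ0
      field_simp at hn
      linear_combination hn
  obtain ⟨L₂, hL₂, hlim₂⟩ := exists_tendsto_prod_one_add (summable_norm_pow_mul hp z⁻¹)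
    fun n hn => h (-n) <| by
      have hQn : Q ^ n ≠ 0 := pow_ne_zero _ hQ0
      rw [zpow_neg, zpow_natCast]
      rw [inv_pow] at hn
      field_simp at hn ⊢
      linear_combination hn
  obtain ⟨L, hL, hlim⟩ := exists_tendsto_qPoch hp
  have hinv := tendsto_qPochInv hL hlim
  obtain ⟨M, hM0, hM⟩ := exists_norm_le_of_tendsto hlim
  obtain ⟨N, hN0, hN⟩ := exists_norm_le_of_tendsto (hlim.inv₀ hL)
  have hN' : ∀ m : ℤ, ‖qPochInv Q⁻¹ m‖ ≤ N := by
    rintro (m | m)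
    · exact hN m
    · simpa [qPochInv] using hN0
  have hsum := summable_theta hQ hz
  have key : Filter.Tendsto
      (fun n => ∑' k : ℤ, centralGaussBinom Q⁻¹ n k * (thetaCoeff Q k * z ^ k)) Filter.atTop
      (nhds (∑' k : ℤ, L * L⁻¹ * L⁻¹ * (thetaCoeff Q k * z ^ k))) := by
    refine tendsto_tsum_of_dominated_convergence
      (bound := fun k => M * N * N * ‖thetaCoeff Q k * z ^ k‖) (hsum.norm.mul_left _)
      (fun k => ?_) (Filter.Eventually.of_forall fun n k => ?_)
    · refine Filter.Tendsto.mul_const _ (Filter.Tendsto.mul (Filter.Tendsto.mul ?_ ?_) ?_)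
      · exact hlim.comp (Filter.tendsto_id.const_mul_atTop' two_pos)
      · exact hinv.comp (Filter.tendsto_atTop_add_const_right _ _ tendsto_natCast_atTop_atTop)
      · exact hinv.comp (Filter.tendsto_atTop_add_const_right _ (-k) tendsto_natCast_atTop_atTop)
    · rw [norm_mul, centralGaussBinom, norm_mul, norm_mul]
      gcongr
      · exact hM _
      · exact hN' _
      · exact hN' _
  rw [tsum_mul_left, ← theta_eq_tsum] at key
  have hprod := hlim₁.mul hlim₂
  simp only [← Finset.prod_mul_distrib] at hprod
  have heq := tendsto_nhds_unique hprod
    (key.congr fun n => (hasSum_finite_tripleProduct hQ hz n).tsum_eq)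
  intro h0
  rw [h0, mul_zero] at heq
  exact mul_ne_zero hL₁ hL₂ heq

/-- The `ℓ`-th monomial of the `q`-Borel transform, divided by the theta function. -/
lemma qBorel_monomial_div_theta {Q : ℂ} (hQ : Q ≠ 0) {lam z : ℂ} (hlam : lam ≠ 0) (hz : z ≠ 0)
    (c : ℂ) (k : ℤ) (ℓ : ℕ) :
    c * thetaCoeff Q (-ℓ) * (Q ^ k * lam) ^ ℓ / theta Q (Q ^ (k + 1) * (lam / z)) =
      thetaCoeff Q (k - ℓ) * (lam / z)⁻¹ ^ (k - ℓ : ℤ) * (theta Q (lam / z)⁻¹)⁻¹ * (c * z ^ ℓ) := by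
  have hw : lam / z ≠ 0 := div_ne_zero hlam hz
  have hk := thetaCoeff_ne_zero hQ k
  have hneg : -(k + 1) = -1 - k := by ring
  obtain ⟨w, rfl⟩ : ∃ w, lam = w * z := ⟨lam / z, by field_simp⟩
  rw [mul_div_cancel_right₀ _ hz] at *
  rw [theta_zpow_mul hQ hw, theta_inv Q hw, hneg, thetaCoeff_neg_one_sub, sub_eq_add_neg,
    thetaCoeff_add hQ, mul_neg, neg_neg, zpow_mul, inv_zpow', neg_add, neg_neg, zpow_add₀ hw (-k),
    zpow_neg, zpow_natCast, zpow_natCast, zpow_add_one₀ hw, mul_pow, mul_pow]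
  have hwk : w ^ k ≠ 0 := zpow_ne_zero _ hw
  field_simp

/-- Fubini for the sheared product `(k, ℓ) ↦ T (k - ℓ) * b ℓ` of two summable families. -/
lemma summable_norm_and_tsum_shear {T : ℤ → ℂ} {b : ℕ → ℂ} (hT : Summable T)
    (hb : Summable fun ℓ => ‖b ℓ‖) :
    (Summable fun k : ℤ => ‖∑' ℓ : ℕ, T (k - ℓ) * b ℓ‖) ∧
      ∑' k : ℤ, ∑' ℓ : ℕ, T (k - ℓ) * b ℓ = (∑' k, T k) * ∑' ℓ, b ℓ := by
  let e : ℤ × ℕ ≃ ℤ × ℕ :=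
    { toFun := fun x => (x.1 - x.2, x.2)
      invFun := fun x => (x.1 + x.2, x.2)
      left_inv := fun x => by simp
      right_inv := fun x => by simp }
  have hF : Summable fun x : ℤ × ℕ => ‖T (x.1 - x.2) * b x.2‖ :=
    (e.summable_iff (f := fun x : ℤ × ℕ => ‖T x.1 * b x.2‖)).mpr (hT.norm.mul_norm hb)
  refine ⟨hF.prod.of_nonneg_of_le (fun _ => norm_nonneg _)
    fun k => norm_tsum_le_tsum_norm (hF.prod_factor k), ?_⟩
  rw [tsum_mul_tsum_of_summable_norm hT.norm hb, ← hF.of_norm.tsum_prod]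
  exact e.tsum_eq (fun x : ℤ × ℕ => T x.1 * b x.2)

/-- `L_{1/d}^{[λ]} ∘ B̂_{1/d}(f) = f` near `0`, for `f` a convergent power series. -/
theorem qLaplace_qBorel_eq_self (q : ℂ) (hq : 1 < ‖q‖) (d : ℕ) (hd : 1 ≤ d) (a : ℕ → ℂ)
    (hconv : ∃ r : ℝ, 0 < r ∧ Summable fun ℓ : ℕ => ‖a ℓ‖ * r ^ ℓ)
    (lam : ℂ) (hlam : lam ≠ 0) :
    letI g : ℂ → ℂ := fun ζ => ∑' ℓ : ℕ, a ℓ * q ^ (-(ℓ * (ℓ - 1) * d : ℤ) / 2) * ζ ^ ℓ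
    ∃ R : ℝ, 0 < R ∧ ∀ z : ℂ, z ≠ 0 → ‖z‖ < R → (∀ k : ℤ, z ≠ -lam * q ^ (d * k)) →
      (Summable fun k : ℤ =>
        ‖g (q ^ (d * k) * lam) / theta (q ^ d) (q ^ ((d : ℤ) + d * k) * lam / z)‖) ∧
      ∑' k : ℤ, g (q ^ (d * k) * lam) / theta (q ^ d) (q ^ ((d : ℤ) + d * k) * lam / z)
        = ∑' ℓ : ℕ, a ℓ * z ^ ℓ := by
  have hq0 : q ≠ 0 := norm_pos_iff.mp (one_pos.trans hq)
  have hQ : 1 < ‖q ^ d‖ := by rw [norm_pow]; exact one_lt_pow₀ hq (by omega)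
  have hQ0 : q ^ d ≠ 0 := pow_ne_zero _ hq0
  obtain ⟨r, hr, hsum⟩ := hconv
  refine ⟨r, hr, fun z hz hzr hzk => ?_⟩
  have hw : lam / z ≠ 0 := div_ne_zero hlam hz
  have hθ : theta (q ^ d) (lam / z)⁻¹ ≠ 0 := by
    rw [theta_inv _ hw]
    refine mul_ne_zero hw (theta_ne_zero hQ hw fun m hm => hzk (-m) ?_)
    have hqm : (q ^ d) ^ m ≠ 0 := zpow_ne_zero _ hQ0
    rw [zpow_mul, zpow_natCast, zpow_neg]
    field_simp at hm ⊢
    linear_combination hm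
  have haz : Summable fun ℓ : ℕ => ‖a ℓ * z ^ ℓ‖ := by
    refine hsum.of_nonneg_of_le (fun _ => norm_nonneg _) fun ℓ => ?_
    rw [norm_mul, norm_pow]
    gcongr
  set T : ℤ → ℂ := fun j => thetaCoeff (q ^ d) j * (lam / z)⁻¹ ^ j * (theta (q ^ d) (lam / z)⁻¹)⁻¹
    with hT
  have hTsum : Summable T := (summable_theta hQ (inv_ne_zero hw)).mul_right _
  have hTone : ∑' j, T j = 1 := by
    rw [hT, tsum_mul_right, ← theta_eq_tsum, mul_inv_cancel₀ hθ]
  have hterm : ∀ k : ℤ, (∑' ℓ : ℕ, a ℓ * q ^ (-(ℓ * (ℓ - 1) * d : ℤ) / 2) * (q ^ (d * k) * lam) ^ ℓ)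
      / theta (q ^ d) (q ^ ((d : ℤ) + d * k) * lam / z) =
      ∑' ℓ : ℕ, T (k - ℓ) * (a ℓ * z ^ ℓ) := by
    intro k
    rw [← tsum_div_const]
    refine tsum_congr fun ℓ => ?_
    have hexp : q ^ (-(ℓ * (ℓ - 1) * d : ℤ) / 2) = thetaCoeff (q ^ d) (-ℓ) := by
      rw [thetaCoeff, ← zpow_natCast, ← zpow_mul]
      congr 1
      refine Int.ediv_eq_of_eq_mul_right two_ne_zero ?_
      linear_combination -(d : ℤ) * two_mul_theta_exponent (-ℓ)
    have hk : q ^ ((d : ℤ) + d * k) = (q ^ d) ^ (k + 1) := by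
      rw [← zpow_natCast, ← zpow_mul]
      congr 1
      ring
    rw [hexp, hk, mul_div_assoc (_ ^ (k + 1)), zpow_mul, zpow_natCast, qBorel_monomial_div_theta hQ0 hlam hz]
  simp only [hterm]
  have h := summable_norm_and_tsum_shear hTsum haz
  rwa [hTone, one_mul] at h
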